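/- Let V be a Banach 𝕆-bimodule and T a bounded right para-linear operator on V. The following are equivalent: (1) [T, T^{⊚n}, x]_⊚ = 0 for all x ∈ V and all n ∈ ℕ; (2) Tⁿ is right para-linear for all n ∈ ℕ; (3) [T^{n⊚}, T, x]_⊚ = 0 for all x ∈ V and all n ∈ ℕ. Moreover, under any of these conditions, T^{⊚n} = Tⁿ = T^{n⊚} for all n ∈ ℕ, and consequently Tⁿ ⊚ Tᵐ = T^{n+m} for all n, m ∈ ℕ. -/

import Mathlib

noncomputable section

open scoped BigOperators

/-- Octonions, realized via the Cayley–Dickson doubling of the quaternions. -/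
@[ext]
structure Oct : Type where
  a : Quaternion ℝ
  b : Quaternion ℝ

namespace Oct

instance : Zero Oct := ⟨⟨0, 0⟩⟩
instance : Add Oct := ⟨fun x y => ⟨x.a + y.a, x.b + y.b⟩⟩
instance : Neg Oct := ⟨fun x => ⟨-x.a, -x.b⟩⟩
instance : Sub Oct := ⟨fun x y => ⟨x.a - y.a, x.b - y.b⟩⟩
instance : SMul ℕ Oct := ⟨fun n x => ⟨n • x.a, n • x.b⟩⟩
instance : SMul ℤ Oct := ⟨fun n x => ⟨n • x.a, n • x.b⟩⟩
instance : SMul ℝ Oct := ⟨fun r x => ⟨r • x.a, r • x.b⟩⟩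

def toLp (x : Oct) : WithLp 2 (Quaternion ℝ × Quaternion ℝ) :=
  (WithLp.equiv 2 (Quaternion ℝ × Quaternion ℝ)).symm (x.a, x.b)

lemma toLp_injective : Function.Injective toLp := by
  rintro ⟨xa, xb⟩ ⟨ya, yb⟩ h
  have ha : xa = ya :=
    congrArg (fun z => (WithLp.equiv 2 (Quaternion ℝ × Quaternion ℝ) z).1) h
  have hb : xb = yb :=
    congrArg (fun z => (WithLp.equiv 2 (Quaternion ℝ × Quaternion ℝ) z).2) h
  subst ha; subst hb; rfl

instance : AddCommGroup Oct :=
  toLp_injective.addCommGroup toLp rfl (fun _ _ => rfl) (fun _ => rfl) (fun _ _ => rfl)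
    (fun _ _ => rfl) (fun _ _ => rfl)

def toLpHom : Oct →+ WithLp 2 (Quaternion ℝ × Quaternion ℝ) where
  toFun := toLp
  map_zero' := rfl
  map_add' _ _ := rfl

instance : Module ℝ Oct := toLp_injective.module ℝ toLpHom fun _ _ => rfl

instance : NormedAddCommGroup Oct :=
  NormedAddCommGroup.induced Oct (WithLp 2 (Quaternion ℝ × Quaternion ℝ)) toLpHom toLp_injective

instance : NormedSpace ℝ Oct := ⟨fun r x => norm_smul_le r (toLp x)⟩

def toProdLin : Oct →ₗ[ℝ] Quaternion ℝ × Quaternion ℝ where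
  toFun x := (x.a, x.b)
  map_add' _ _ := rfl
  map_smul' _ _ := rfl

lemma toProdLin_injective : Function.Injective toProdLin := by
  rintro ⟨xa, xb⟩ ⟨ya, yb⟩ h
  have ha : xa = ya := congrArg Prod.fst h
  have hb : xb = yb := congrArg Prod.snd h
  subst ha; subst hb; rfl

instance : FiniteDimensional ℝ Oct :=
  FiniteDimensional.of_injective toProdLin toProdLin_injective

instance : CompleteSpace Oct := FiniteDimensional.complete ℝ Oct

instance : One Oct := ⟨⟨1, 0⟩⟩

instance : Mul Oct :=
  ⟨fun x y => ⟨x.a * y.a - star y.b * x.b, y.b * x.a + x.b * star y.a⟩⟩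

/-- Octonionic conjugation. -/
def conj (x : Oct) : Oct := ⟨star x.a, -x.b⟩

/-- The real part of an octonion. -/
def re (x : Oct) : ℝ := x.a.re

/-- Powers of an octonion (association chosen on the left factor). -/
def opow (s : Oct) : ℕ → Oct
  | 0 => 1
  | n + 1 => s * opow s n

/-- The inverse of a nonzero octonion. -/
def oinv (s : Oct) : Oct := (‖s‖ ^ 2)⁻¹ • conj s

/-- `invPow s n` is the octonion `s ^ (-1 - n)`. -/
def invPow (s : Oct) (n : ℕ) : Oct := opow (oinv s) (n + 1)

def eNat : ℕ → Oct
  | 0 => ⟨1, 0⟩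
  | 1 => ⟨⟨0, 1, 0, 0⟩, 0⟩
  | 2 => ⟨⟨0, 0, 1, 0⟩, 0⟩
  | 3 => ⟨⟨0, 0, 0, 1⟩, 0⟩
  | 4 => ⟨0, 1⟩
  | 5 => ⟨0, ⟨0, 1, 0, 0⟩⟩
  | 6 => ⟨0, ⟨0, 0, 1, 0⟩⟩
  | 7 => ⟨0, ⟨0, 0, 0, 1⟩⟩
  | _ => 0

/-- The standard basis `e_0 = 1, e_1, …, e_7` of the octonions. -/
def e (i : Fin 8) : Oct := eNat i.val

/-- The six-dimensional sphere `𝕊` of imaginary units of `𝕆`. -/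
def unitSphere : Set Oct := {J | J * J = -1}

/-- The slice `ℂ_J = ℝ ⊕ ℝJ` of the octonions. -/
def sliceC (J : Oct) : Set Oct := {s | ∃ x y : ℝ, s = x • (1 : Oct) + y • J}

/-- The embedding of `ℂ` onto the slice `ℂ_J`, `x + y i ↦ x + y J`. -/
def toSlice (J : Oct) (z : ℂ) : Oct := z.re • (1 : Oct) + z.im • J

end Oct

open Oct

/-- A (normed/Banach) `𝕆`-bimodule: a real normed space with continuous real-bilinear left and
right octonionic multiplications satisfying the alternativity relations
`[p,q,x] = [q,x,p] = [x,p,q] = -[q,p,x]` and the norm identities `‖px‖ = |p|‖x‖ = ‖xp‖`. -/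
class OctBimodule (V : Type*) [NormedAddCommGroup V] [NormedSpace ℝ V] : Type _ where
  lm : Oct →ₗ[ℝ] V →L[ℝ] V
  rm : Oct →ₗ[ℝ] V →L[ℝ] V
  lm_one : ∀ x : V, lm 1 x = x
  rm_one : ∀ x : V, rm 1 x = x
  /-- `[p,q,x] = [q,x,p]` -/
  assoc_cyc₁ : ∀ (p q : Oct) (x : V),
    lm (p * q) x - lm p (lm q x) = rm p (lm q x) - lm q (rm p x)
  /-- `[p,q,x] = [x,p,q]` -/
  assoc_cyc₂ : ∀ (p q : Oct) (x : V),
    lm (p * q) x - lm p (lm q x) = rm q (rm p x) - rm (p * q) x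
  /-- `[p,q,x] = -[q,p,x]` -/
  assoc_alt : ∀ (p q : Oct) (x : V),
    lm (p * q) x - lm p (lm q x) = -(lm (q * p) x - lm q (lm p x))
  norm_lm : ∀ (p : Oct) (x : V), ‖lm p x‖ = ‖p‖ * ‖x‖
  norm_rm : ∀ (p : Oct) (x : V), ‖rm p x‖ = ‖p‖ * ‖x‖

section OctMod

variable {V : Type*} [NormedAddCommGroup V] [NormedSpace ℝ V] [OctBimodule V]

/-- Left multiplication `x ↦ p x` as a bounded real-linear operator. -/
def lmo (p : Oct) : V →L[ℝ] V := OctBimodule.lm p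

/-- Right multiplication `R_p : x ↦ x p` as a bounded real-linear operator. -/
def rmo (p : Oct) : V →L[ℝ] V := OctBimodule.rm p

variable (V)

/-- The real-part projection `Re x = (5/12) x - (1/12) ∑_{i=1}^7 e_i x e_i` of an
`𝕆`-bimodule. -/
def reO : V →L[ℝ] V :=
  (5 / 12 : ℝ) • ContinuousLinearMap.id ℝ V -
    (1 / 12 : ℝ) • ∑ i : Fin 7, (rmo (e i.succ)).comp (lmo (e i.succ))

/-- The real part `Re V` of an `𝕆`-bimodule, i.e. the set of associative central elements. -/
def ReSet : Set V :=
  {m | (∀ p q : Oct, lmo (p * q) m = lmo p (lmo q m)) ∧ ∀ p : Oct, lmo p m = rmo p m}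

/-- The slice `ℂ_J(V) = Re V ⊕ J · Re V` of an `𝕆`-bimodule. -/
def CJV (J : Oct) : Set V :=
  {x | ∃ u ∈ ReSet V, ∃ w ∈ ReSet V, x = u + lmo J w}

/-- The slice projection `π_J(x) = Re x + J Re (J̄ x)`. -/
def piJ (J : Oct) : V →L[ℝ] V :=
  reO V + (lmo J).comp ((reO V).comp (lmo (Oct.conj J)))

variable {V}

/-- The second right associator `B_p(T, x) = T(x) p - T(x p)` of an operator. -/
def Bop (p : Oct) (T : V →L[ℝ] V) : V →L[ℝ] V := (rmo p).comp T - T.comp (rmo p)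

/-- A bounded real-linear operator is right (octonionic) para-linear if `Re B_p(T,x) = 0`. -/
def IsRightPara (T : V →L[ℝ] V) : Prop := ∀ (p : Oct) (x : V), reO V (Bop p T x) = 0

/-- The left octonionic scalar multiplication `(p ⊙ T)(x) = p T(x) + B_p(T,x)` on operators. -/
def odotL (p : Oct) (T : V →L[ℝ] V) : V →L[ℝ] V := (lmo p).comp T + Bop p T

/-- The right octonionic scalar multiplication `(T ⊙ p)(x) = T(p x) - B_p(T,x)` on operators. -/
def odotR (T : V →L[ℝ] V) (p : Oct) : V →L[ℝ] V := T.comp (lmo p) - Bop p T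

/-- The lifting map, `(lif F)(x) = ∑_i F(x ē_i) e_i`. -/
def lifO (F : V →L[ℝ] V) : V →L[ℝ] V :=
  ∑ i : Fin 8, (rmo (e i)).comp (F.comp (rmo (Oct.conj (e i))))

/-- The extension map, `(ext G)(∑ x_i e_i) = ∑ G(x_i) e_i`, where `x_i = Re (x ē_i)`. -/
def extO (G : V →L[ℝ] V) : V →L[ℝ] V :=
  ∑ i : Fin 8, (rmo (e i)).comp (G.comp ((reO V).comp (rmo (Oct.conj (e i)))))

/-- The left regular power `T^{n⊚} = lif (Re ∘ Tⁿ)`. -/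
def rpowL (T : V →L[ℝ] V) (n : ℕ) : V →L[ℝ] V := lifO ((reO V).comp (T ^ n))

/-- The right regular power `T^{⊚n} = ext (Tⁿ|_{Re V})`. -/
def rpowR (T : V →L[ℝ] V) (n : ℕ) : V →L[ℝ] V := extO (T ^ n)

/-- The regular composition `f ⊚ g = lif (Re ∘ f ∘ g)`. -/
def rcomp (f g : V →L[ℝ] V) : V →L[ℝ] V := lifO ((reO V).comp (f.comp g))

/-- The composition associator `[f,g,x]_⊚ = (f ⊚ g)(x) - f(g(x))`. -/
def compAssoc (f g : V →L[ℝ] V) (x : V) : V := rcomp f g x - f (g x)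

/-- The right regular inverse `T^{⊚-} = ext (T⁻¹|_{Re V})` of an invertible operator. -/
def rinvR (T : V →L[ℝ] V) : V →L[ℝ] V := extO (Ring.inverse T)

/-- The left regular inverse `T^{-⊚} = lif (Re ∘ T⁻¹)` of an invertible operator. -/
def rinvL (T : V →L[ℝ] V) : V →L[ℝ] V := lifO ((reO V).comp (Ring.inverse T))

/-- An operator is power-associative if all of its (composition) powers are right
para-linear. -/
def IsPowerAssoc (T : V →L[ℝ] V) : Prop := ∀ n : ℕ, IsRightPara (T ^ n)

/-- A bounded operator is octonionic linear if `T(xp) = T(x)p` for all `p`. -/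
def IsOctLinear (T : V →L[ℝ] V) : Prop := ∀ (p : Oct) (x : V), T (rmo p x) = rmo p (T x)

/-- `S` is `ℂ_J`-extendable power associative: `Sⁿ(v s) = Sⁿ(v) s` for `v ∈ Re V`,
`s ∈ ℂ_J`, `n ≥ 1`. -/
def CJExtPA (J : Oct) (S : V →L[ℝ] V) : Prop :=
  ∀ n : ℕ, 1 ≤ n → ∀ v ∈ ReSet V, ∀ s ∈ sliceC J, (S ^ n) (rmo s v) = rmo s ((S ^ n) v)

/-- `S` is `ℂ_J`-liftable power associative: `Re (Sⁿ(v s)) = Re (Sⁿ(v) s)` for all `v ∈ V`,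
`s ∈ ℂ_J`, `n ≥ 1`. -/
def CJLiftPA (J : Oct) (S : V →L[ℝ] V) : Prop :=
  ∀ n : ℕ, 1 ≤ n → ∀ (v : V), ∀ s ∈ sliceC J,
    reO V ((S ^ n) (rmo s v)) = reO V (rmo s ((S ^ n) v))

/-- The pull-back slice-resolvent set `ρ*_J(T)`. -/
def pbResSlice (T : V →L[ℝ] V) (J : Oct) : Set Oct :=
  {s | s ∈ sliceC J ∧ IsUnit ((rmo s : V →L[ℝ] V) - T) ∧
    CJExtPA J (Ring.inverse ((rmo s : V →L[ℝ] V) - T))}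

/-- The pull-back resolvent set `ρ*(T)`. -/
def pbRes (T : V →L[ℝ] V) : Set Oct := ⋃ J ∈ unitSphere, pbResSlice T J

/-- The pull-back spectrum `σ*(T) = 𝕆 ∖ ρ*(T)`. -/
def pbSpec (T : V →L[ℝ] V) : Set Oct := Set.univ \ pbRes T

/-- The push-forward slice-resolvent set `ρ_{*J}(T)`. -/
def pfResSlice (T : V →L[ℝ] V) (J : Oct) : Set Oct :=
  {s | s ∈ sliceC J ∧ IsUnit ((rmo s : V →L[ℝ] V) - T) ∧
    CJLiftPA J (Ring.inverse ((rmo s : V →L[ℝ] V) - T))}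

/-- The push-forward resolvent set `ρ_*(T)`. -/
def pfRes (T : V →L[ℝ] V) : Set Oct := ⋃ J ∈ unitSphere, pfResSlice T J

/-- The push-forward spectrum `σ_*(T) = 𝕆 ∖ ρ_*(T)`. -/
def pfSpec (T : V →L[ℝ] V) : Set Oct := Set.univ \ pfRes T

/-- The real-part projection of the `𝕆`-bimodule `𝓑_RO(V)` of bounded right para-linear
operators, given by `Re A = (5/12) A - (1/12) ∑_{i=1}^7 (e_i ⊙ A) ⊙ e_i`. -/
def reOpB (A : V →L[ℝ] V) : V →L[ℝ] V :=
  (5 / 12 : ℝ) • A - (1 / 12 : ℝ) • ∑ i : Fin 7, odotR (odotL (e i.succ) A) (e i.succ)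

end OctMod

/-- A set `U ⊆ 𝕆` is slice-open if `U ∩ ℂ_J` is open in `ℂ_J` for every `J ∈ 𝕊`. -/
def SliceOpen (U : Set Oct) : Prop :=
  ∀ J ∈ unitSphere, IsOpen (Oct.toSlice J ⁻¹' U)

/-- A parametrization of the boundary `∂(U ∩ ℂ_J)` by finitely many continuously
differentiable, positively oriented Jordan curves (positivity of the orientation is encoded
through the winding numbers). -/
structure SliceContour (J : Oct) (U : Set Oct) where
  n : ℕ
  γ : Fin n → ℝ → ℂ
  smooth : ∀ i, ContDiff ℝ 1 (γ i)
  closed : ∀ i, γ i 0 = γ i 1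
  jordan : ∀ i, Set.InjOn (γ i) (Set.Ico (0 : ℝ) 1)
  image_eq : (⋃ i, γ i '' Set.Icc (0 : ℝ) 1) = frontier (Oct.toSlice J ⁻¹' U)
  winding_inside : ∀ z : ℂ, Oct.toSlice J z ∈ U →
    (∑ i, ∫ t in (0 : ℝ)..1, deriv (γ i) t / (γ i t - z)) = 2 * (Real.pi : ℂ) * Complex.I
  winding_outside : ∀ z : ℂ, Oct.toSlice J z ∉ closure U →
    (∑ i, ∫ t in (0 : ℝ)..1, deriv (γ i) t / (γ i t - z)) = 0

/-- The integral `∫_{∂(U ∩ ℂ_J)} Φ(s, ds)` along a slice contour: the integrand gets the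
point of the curve and its derivative (both in the coordinates of the slice). -/
def contourSum {J : Oct} {U : Set Oct} (Γ : SliceContour J U) {E : Type*}
    [NormedAddCommGroup E] [NormedSpace ℝ E] (Φ : ℂ → ℂ → E) : E :=
  ∑ i, ∫ t in (0 : ℝ)..1, Φ (Γ.γ i t) (deriv (Γ.γ i) t)

/-- An axially symmetric slice domain (s-domain) in `𝕆`. -/
structure IsAdmissibleDomain (U : Set Oct) : Prop where
  isOpen : IsOpen U
  isConnected : IsConnected U
  real_nonempty : (U ∩ {s : Oct | ∃ r : ℝ, s = r • (1 : Oct)}).Nonempty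
  axially : ∀ (z : ℂ), ∀ I ∈ unitSphere, ∀ J ∈ unitSphere,
    Oct.toSlice I z ∈ U → Oct.toSlice J z ∈ U
  slice_conn : ∀ J ∈ unitSphere, IsConnected (Oct.toSlice J ⁻¹' U)

section Adm

variable {V : Type*} [NormedAddCommGroup V] [NormedSpace ℝ V] [OctBimodule V]

/-- A `T`-left-admissible domain: an axially symmetric s-domain containing the pull-back
spectrum `σ*(T)`.  (The regularity of its slice boundaries is witnessed by the slice
contours used in the integrals.) -/
def LeftAdmissible (T : V →L[ℝ] V) (U : Set Oct) : Prop :=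
  IsAdmissibleDomain U ∧ pbSpec T ⊆ U

/-- A `T`-right-admissible domain: an axially symmetric s-domain containing the push-forward
spectrum `σ_*(T)`. -/
def RightAdmissible (T : V →L[ℝ] V) (U : Set Oct) : Prop :=
  IsAdmissibleDomain U ∧ pfSpec T ⊆ U

end Adm

/-- The axially symmetric set `Ω_D ⊆ 𝕆` induced by a conjugation-invariant set `D ⊆ ℂ`. -/
def OmegaD (D : Set ℂ) : Set Oct := ⋃ J ∈ unitSphere, Oct.toSlice J '' D

/-- `F` is the stem of a slice preserving slice regular function on `Ω_D`: it is holomorphic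
on the open conjugation-invariant set `D` and intertwines complex conjugation. -/
structure IsStem (D : Set ℂ) (F : ℂ → ℂ) : Prop where
  isOpen : IsOpen D
  conj_mem : ∀ z ∈ D, (starRingEnd ℂ) z ∈ D
  holo : DifferentiableOn ℂ F D
  conj_comm : ∀ z ∈ D, F ((starRingEnd ℂ) z) = (starRingEnd ℂ) (F z)

section FC

variable {V : Type*} [NormedAddCommGroup V] [NormedSpace ℝ V] [OctBimodule V]

/-- The slice integral `(1/2π) ∫_{∂(U∩ℂ_J)} (R_s - T)^{⊚-} ⊙ (ds_J f(s))` defining the left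
slice regular functional calculus of a slice preserving function with stem `F`. -/
def leftFC (T : V →L[ℝ] V) (J : Oct) {U : Set Oct} (Γ : SliceContour J U)
    (F : ℂ → ℂ) : V →L[ℝ] V :=
  (2 * Real.pi)⁻¹ • contourSum Γ fun z dz =>
    odotR (rinvR ((rmo (Oct.toSlice J z) : V →L[ℝ] V) - T))
      ((-(Oct.toSlice J dz) * J) * Oct.toSlice J (F z))

/-- The slice integral `(1/2π) ∫_{∂(U∩ℂ_J)} (f(s) ds_J) ⊙ (R_s - T)^{-⊚}` defining the right
slice regular functional calculus of a slice preserving function with stem `F`. -/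
def rightFC (T : V →L[ℝ] V) (J : Oct) {U : Set Oct} (Γ : SliceContour J U)
    (F : ℂ → ℂ) : V →L[ℝ] V :=
  (2 * Real.pi)⁻¹ • contourSum Γ fun z dz =>
    odotL (Oct.toSlice J (F z) * (-(Oct.toSlice J dz) * J))
      (rinvL ((rmo (Oct.toSlice J z) : V →L[ℝ] V) - T))

end FC

/-- The family of stems of the components, relative to `J = ∑ c_i e_i`, of a function of the
form `f₀ + f₁ • J` with `f₀, f₁` slice preserving with stems `F₀, F₁`. -/
def stemFamily (c : Fin 8 → ℝ) (F₀ F₁ : ℂ → ℂ) : Fin 8 → ℂ → ℂ :=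
  fun i z => if i = 0 then F₀ z else (c i : ℂ) * F₁ z

namespace Oct

/-- Left multiplication by an octonion, as a real-linear map. -/
def lmulLin (q : Oct) : Oct →ₗ[ℝ] Oct where
  toFun x := q * x
  map_add' x y := by
    refine Oct.ext ?_ ?_
    · show q.a * (x.a + y.a) - star (x.b + y.b) * q.b =
        (q.a * x.a - star x.b * q.b) + (q.a * y.a - star y.b * q.b)
      rw [mul_add, star_add, add_mul]; abel
    · show (x.b + y.b) * q.a + q.b * star (x.a + y.a) =
        (x.b * q.a + q.b * star x.a) + (y.b * q.a + q.b * star y.a)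
      rw [add_mul, star_add, mul_add]; abel
  map_smul' r x := by
    refine Oct.ext ?_ ?_
    · show q.a * (r • x.a) - star (r • x.b) * q.b = r • (q.a * x.a - star x.b * q.b)
      rw [mul_smul_comm, Quaternion.star_smul, smul_mul_assoc, smul_sub]
    · show (r • x.b) * q.a + q.b * star (r • x.a) = r • (x.b * q.a + q.b * star x.a)
      rw [smul_mul_assoc, Quaternion.star_smul, mul_smul_comm, smul_add]

/-- Left multiplication `L_q : x ↦ q x` as a bounded real-linear operator on `𝕆`. -/
def Lq (q : Oct) : Oct →L[ℝ] Oct := (lmulLin q).toContinuousLinearMap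

/-- The two-sphere `[q] = {Re q + |Im q| J : J ∈ 𝕊}` associated with an octonion `q`. -/
def qSphere (q : Oct) : Set Oct :=
  {s | ∃ J ∈ unitSphere, s = Oct.re q • (1 : Oct) + ‖q - Oct.re q • (1 : Oct)‖ • J}

end Oct


namespace Oct

/-- The eight real coordinates of an octonion in the standard basis. -/
def coord (x : Oct) : Fin 8 → ℝ :=
  ![x.a.re, x.a.imI, x.a.imJ, x.a.imK, x.b.re, x.b.imI, x.b.imJ, x.b.imK]

theorem coord_injective : Function.Injective coord := by
  intro x y h
  have h' := fun i => congrFun h i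
  exact Oct.ext (QuaternionAlgebra.ext (h' 0) (h' 1) (h' 2) (h' 3))
    (QuaternionAlgebra.ext (h' 4) (h' 5) (h' 6) (h' 7))

theorem coord_add (x y : Oct) (i : Fin 8) : coord (x + y) i = coord x i + coord y i := by
  fin_cases i <;> rfl

theorem coord_neg (x : Oct) (i : Fin 8) : coord (-x) i = -coord x i := by
  fin_cases i <;> rfl

theorem coord_smul (r : ℝ) (x : Oct) (i : Fin 8) : coord (r • x) i = r * coord x i := by
  fin_cases i <;> rfl

theorem coord_e (i j : Fin 8) : coord (e i) j = if j = i then 1 else 0 := by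
  fin_cases i <;> fin_cases j <;> rfl

theorem e_zero : e 0 = 1 := rfl

theorem coord_one (j : Fin 8) : coord 1 j = if j = 0 then 1 else 0 := coord_e 0 j

theorem re_eq_coord (x : Oct) : re x = coord x 0 := rfl

theorem coord_conj (x : Oct) (i : Fin 8) :
    coord (conj x) i = if i = 0 then coord x i else -coord x i := by
  fin_cases i <;> simp [coord, conj]

theorem mul_a (x y : Oct) : (x * y).a = x.a * y.a - star y.b * x.b := rfl

theorem mul_b (x y : Oct) : (x * y).b = y.b * x.a + x.b * star y.a := rfl

theorem coord_mul (x y : Oct) : coord (x * y) =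
    let s := coord x
    let t := coord y
    ![s 0 * t 0 - s 1 * t 1 - s 2 * t 2 - s 3 * t 3 - s 4 * t 4 - s 5 * t 5 - s 6 * t 6 - s 7 * t 7,
      s 0 * t 1 + s 1 * t 0 + s 2 * t 3 - s 3 * t 2 + s 4 * t 5 - s 5 * t 4 - s 6 * t 7 + s 7 * t 6,
      s 0 * t 2 - s 1 * t 3 + s 2 * t 0 + s 3 * t 1 + s 4 * t 6 + s 5 * t 7 - s 6 * t 4 - s 7 * t 5,
      s 0 * t 3 + s 1 * t 2 - s 2 * t 1 + s 3 * t 0 + s 4 * t 7 - s 5 * t 6 + s 6 * t 5 - s 7 * t 4,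
      s 0 * t 4 - s 1 * t 5 - s 2 * t 6 - s 3 * t 7 + s 4 * t 0 + s 5 * t 1 + s 6 * t 2 + s 7 * t 3,
      s 0 * t 5 + s 1 * t 4 - s 2 * t 7 + s 3 * t 6 - s 4 * t 1 + s 5 * t 0 - s 6 * t 3 + s 7 * t 2,
      s 0 * t 6 + s 1 * t 7 + s 2 * t 4 - s 3 * t 5 - s 4 * t 2 + s 5 * t 3 + s 6 * t 0 - s 7 * t 1,
      s 0 * t 7 - s 1 * t 6 + s 2 * t 5 + s 3 * t 4 - s 4 * t 3 - s 5 * t 2 + s 6 * t 1 + s 7 * t 0] := by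
  funext i
  fin_cases i <;> simp [coord, mul_a, mul_b] <;> ring

theorem mul_add_mul_swap_of_re_eq_zero {p q : Oct} (hp : re p = 0) (hq : re q = 0) :
    p * q + q * p = (-2 * ∑ i : Fin 7, coord p i.succ * coord q i.succ) • (1 : Oct) := by
  rw [re_eq_coord] at hp hq
  apply coord_injective
  funext i
  rw [coord_add, coord_mul, coord_mul, coord_smul, coord_one, Fin.sum_univ_seven]
  fin_cases i <;> simp [hp, hq] <;> ring

theorem re_e_succ (i : Fin 7) : re (e i.succ) = 0 := by
  rw [re_eq_coord, coord_e, if_neg (Fin.succ_ne_zero i).symm]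

theorem conj_e_zero : conj (e 0) = 1 := by
  apply coord_injective
  funext j
  rw [coord_conj, coord_e, coord_one]
  split_ifs <;> simp

theorem conj_e_succ (i : Fin 7) : conj (e i.succ) = -e i.succ := by
  apply coord_injective
  funext j
  rw [coord_conj, coord_neg, coord_e]
  by_cases h : j = 0
  · simp [h, (Fin.succ_ne_zero i).symm]
  · simp [h]

theorem e_succ_mul_self (i : Fin 7) : e i.succ * e i.succ = -1 := by
  have h := mul_add_mul_swap_of_re_eq_zero (re_e_succ i) (re_e_succ i)
  rw [← two_smul ℝ, mul_smul] at h
  refine smul_right_injective Oct (two_ne_zero' ℝ) ?_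
  simp only [coord_e] at h
  simp at h ⊢
  exact h

theorem e_succ_mul_e_succ {i j : Fin 7} (h : i ≠ j) :
    e i.succ * e j.succ = -(e j.succ * e i.succ) := by
  rw [eq_neg_iff_add_eq_zero, mul_add_mul_swap_of_re_eq_zero (re_e_succ i) (re_e_succ j)]
  simp [coord_e, h.symm]

theorem sum_re_e_mul_smul_conj_e (p : Oct) :
    ∑ i : Fin 8, re (e i * p) • conj (e i) = p := by
  apply coord_injective
  funext j
  simp only [Fin.sum_univ_eight, coord_add, coord_smul, coord_conj, coord_e, re_eq_coord,
    coord_mul]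
  fin_cases j <;> simp

/-- `IsLine i j k` says that `e_{i+1}`, `e_{j+1}`, `e_{k+1}` form, in this cyclic order, a
quaternionic triple, that is an oriented line of the Fano plane. -/
def IsLine (i j k : Fin 7) : Prop :=
  (i, j, k) ∈ [((0 : Fin 7), (1 : Fin 7), (2 : Fin 7)), (1, 2, 0), (2, 0, 1),
    (0, 3, 4), (3, 4, 0), (4, 0, 3), (0, 6, 5), (6, 5, 0), (5, 0, 6),
    (1, 3, 5), (3, 5, 1), (5, 1, 3), (1, 4, 6), (4, 6, 1), (6, 1, 4),
    (2, 3, 6), (3, 6, 2), (6, 2, 3), (2, 5, 4), (5, 4, 2), (4, 2, 5)]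

instance (i j k : Fin 7) : Decidable (IsLine i j k) := by
  unfold IsLine
  infer_instance

theorem IsLine.rotate {i j k : Fin 7} : IsLine i j k → IsLine j k i := by
  revert i j k
  decide

theorem IsLine.ne {i j k : Fin 7} : IsLine i j k → i ≠ j := by
  revert i j k
  decide

theorem IsLine.mul_eq {i j k : Fin 7} (h : IsLine i j k) : e i.succ * e j.succ = e k.succ := by
  simp only [IsLine, List.mem_cons, Prod.mk.injEq, List.not_mem_nil, or_false] at h
  apply coord_injective
  funext n
  rw [coord_mul, coord_e]
  rcases h with h | h | h | h | h | h | h | h | h | h | h | h | h | h | h | h | h | h | h | h | h <;>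
  · obtain ⟨rfl, rfl, rfl⟩ := h
    fin_cases n <;> simp [coord_e]

theorem IsLine.mul_eq_neg {i j k : Fin 7} (h : IsLine i j k) :
    e i.succ * e k.succ = -e j.succ := by
  rw [e_succ_mul_e_succ h.rotate.rotate.ne.symm, h.rotate.rotate.mul_eq]

theorem exists_isLine_notMem :
    ∀ i : Fin 7, ∃ a b c, IsLine a b c ∧ i ≠ a ∧ i ≠ b ∧ i ≠ c := by
  decide

end Oct

section RingIdentities

variable {A : Type*} [Ring A]

theorem one_add_mul_mul_add_eq_zero {a b c a' b' c' : A} (haa : a * a = -1) (hcc : c * c = -1)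
    (hba : b * a = -(a * b)) (hca : c * a = -(a * c)) (hcb : c * b = -(b * c))
    (haa' : a' * a' = -1) (h₁ : c - a * b = b' * a' - c') (h₂ : -b - a * c = c' * a' + b') :
    (1 + a * b * c) * (a + a') = 0 := by
  have h : (c - a * b) * (a + a') = 0 := by
    linear_combination (norm := noncomm_ring)
      h₁ * a' + b' * haa' + h₂ + hca - a * hba + haa * b
  have h' : 1 + a * b * c = -(c * (c - a * b)) := by
    linear_combination (norm := noncomm_ring) hcc - hca * b + a * hcb
  rw [h', neg_mul, mul_assoc, h, mul_zero, neg_zero]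

theorem two_mul_mul_eq {a b c a' w' : A} (haa : a * a = -1) (hbb : b * b = -1)
    (hba : b * a = -(a * b)) (hca : c * a = -(a * c)) (hbw : b * w' = -(w' * b))
    (h₁ : c - a * b = a' * b - b * a') (hw : (1 + w') * (a + a') = 0) :
    2 * (a' * a) = 1 + a * b * c + w' - w' * (a * b * c) := by
  have h : 2 * (b * a') = -((1 + w') * c) - b * (1 + w') * a := by
    linear_combination (norm := noncomm_ring) (1 + w') * h₁ + hw * b + b * hw - hbw * a'
  have h' : 2 * a' = (1 - w') * b * c - (1 + w') * a := by
    linear_combination (norm := noncomm_ring)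
      -b * h + hbb * a' * 2 + hbw * c + hbb * (1 + w') * a
  linear_combination (norm := noncomm_ring)
    h' * a + (1 - w') * b * hca - (1 - w') * hba * c - (1 + w') * haa

theorem eq_neg_mul_of_three [Module ℝ A] {b z w w' w'' : A} (hbb : b * b = -1)
    (h₁ : z = 1 + w + w' - w' * w) (h₂ : z = 1 + w + w'' - w'' * w)
    (hbw : b * w = -(w * b)) (hbw' : b * w' = w' * b) (hbw'' : b * w'' = -(w'' * b)) :
    w'' * w = -w' := by
  have h : (w' - w'') * (1 - w) = 0 := by
    linear_combination (norm := noncomm_ring) h₂ - h₁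
  have h' : (w' + w'') * (1 + w) = 0 := by
    linear_combination (norm := noncomm_ring) -b * h * b + hbw' * b - hbw'' * b
      + (w' + w'') * hbb + w' * (hbb * w) + w'' * hbb * w - hbw' * w * b + hbw'' * w * b
      - w' * hbw * b - w'' * hbw * b + (w' + w'') * w * hbb - w' * hbb * w - w'' * hbb * w
  have h'' : (2 : ℝ) • (w'' * w + w') = 0 := by
    rw [two_smul]
    linear_combination (norm := noncomm_ring) h + h'
  exact eq_neg_of_add_eq_zero_left ((smul_eq_zero_iff_right two_ne_zero).1 h'')

theorem mul_mul_mul_self {a b c : A} (haa : a * a = -1) (hbb : b * b = -1) (hcc : c * c = -1)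
    (hba : b * a = -(a * b)) (hca : c * a = -(a * c)) (hcb : c * b = -(b * c)) :
    a * b * c * (a * b * c) = 1 := by
  linear_combination (norm := noncomm_ring)
    a * b * hca * b * c - a * hba * c * b * c + haa * b * c * b * c - b * hcb * c + hbb * c * c
      - hcc

end RingIdentities

section BimoduleOperators

variable {V : Type*} [NormedAddCommGroup V] [NormedSpace ℝ V] [OctBimodule V]

theorem lmo_one : (lmo 1 : V →L[ℝ] V) = 1 := ContinuousLinearMap.ext OctBimodule.lm_one

theorem rmo_one : (rmo 1 : V →L[ℝ] V) = 1 := ContinuousLinearMap.ext OctBimodule.rm_one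

theorem lmo_neg (p : Oct) : (lmo (-p) : V →L[ℝ] V) = -lmo p := map_neg OctBimodule.lm p

theorem rmo_neg (p : Oct) : (rmo (-p) : V →L[ℝ] V) = -rmo p := map_neg OctBimodule.rm p

theorem lmo_mul_sub_eq_rmo_mul_lmo_sub (p q : Oct) :
    (lmo (p * q) - lmo p * lmo q : V →L[ℝ] V) = rmo p * lmo q - lmo q * rmo p :=
  ContinuousLinearMap.ext (OctBimodule.assoc_cyc₁ p q)

theorem lmo_mul_sub_eq_rmo_mul_rmo_sub (p q : Oct) :
    (lmo (p * q) - lmo p * lmo q : V →L[ℝ] V) = rmo q * rmo p - rmo (p * q) :=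
  ContinuousLinearMap.ext (OctBimodule.assoc_cyc₂ p q)

theorem lmo_mul_sub_eq_neg (p q : Oct) :
    (lmo (p * q) - lmo p * lmo q : V →L[ℝ] V) = -(lmo (q * p) - lmo q * lmo p) :=
  ContinuousLinearMap.ext (OctBimodule.assoc_alt p q)

theorem lmo_mul_self (p : Oct) : (lmo (p * p) : V →L[ℝ] V) = lmo p * lmo p := by
  have h : (2 : ℝ) • (lmo (p * p) - lmo p * lmo p : V →L[ℝ] V) = 0 := by
    rw [two_smul, ← eq_neg_iff_add_eq_zero]
    exact lmo_mul_sub_eq_neg p p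
  exact sub_eq_zero.1 ((smul_eq_zero_iff_right two_ne_zero).1 h)

theorem rmo_mul_self (p : Oct) : (rmo (p * p) : V →L[ℝ] V) = rmo p * rmo p := by
  have h := lmo_mul_sub_eq_rmo_mul_rmo_sub (V := V) p p
  rw [lmo_mul_self, sub_self] at h
  exact (sub_eq_zero.1 h.symm).symm

/-- Left multiplication by the imaginary unit `e_{i+1}`. -/
def lmE (i : Fin 7) : V →L[ℝ] V := lmo (e i.succ)

/-- Right multiplication by the imaginary unit `e_{i+1}`. -/
def rmE (i : Fin 7) : V →L[ℝ] V := rmo (e i.succ)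

/-- The composition of the left multiplications by three imaginary units. -/
def lineOp (i j k : Fin 7) : V →L[ℝ] V := lmE i * lmE j * lmE k

theorem lmE_mul_self (i : Fin 7) : (lmE i * lmE i : V →L[ℝ] V) = -1 := by
  rw [lmE, ← lmo_mul_self, e_succ_mul_self, lmo_neg, lmo_one]

theorem rmE_mul_self (i : Fin 7) : (rmE i * rmE i : V →L[ℝ] V) = -1 := by
  rw [rmE, ← rmo_mul_self, e_succ_mul_self, rmo_neg, rmo_one]

theorem lmE_mul_lmE {i j : Fin 7} (h : i ≠ j) :
    (lmE i * lmE j : V →L[ℝ] V) = -(lmE j * lmE i) := by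
  have h' := lmo_mul_sub_eq_neg (V := V) (e i.succ) (e j.succ)
  rw [e_succ_mul_e_succ h, lmo_neg] at h'
  unfold lmE
  linear_combination (norm := abel) -h'

theorem lmE_mul_lineOp_of_ne {x i j k : Fin 7} (hi : x ≠ i) (hj : x ≠ j) (hk : x ≠ k) :
    (lmE x * lineOp i j k : V →L[ℝ] V) = -(lineOp i j k * lmE x) := by
  have h₁ := lmE_mul_lmE (V := V) hi
  have h₂ := lmE_mul_lmE (V := V) hj
  have h₃ := lmE_mul_lmE (V := V) hk
  unfold lineOp
  linear_combination (norm := noncomm_ring)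
    h₁ * lmE j * lmE k - lmE i * h₂ * lmE k + lmE i * lmE j * h₃

variable {i j k : Fin 7}

theorem lineOp_rotate (h : IsLine i j k) : (lineOp j k i : V →L[ℝ] V) = lineOp i j k := by
  have h₁ := lmE_mul_lmE (V := V) h.ne
  have h₂ := lmE_mul_lmE (V := V) h.rotate.rotate.ne
  unfold lineOp
  linear_combination (norm := noncomm_ring) lmE j * h₂ - h₁ * lmE k

theorem lmE_mul_lineOp_left (h : IsLine i j k) :
    (lmE i * lineOp i j k : V →L[ℝ] V) = lineOp i j k * lmE i := by
  rw [← lineOp_rotate h]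
  conv_rhs => rw [lineOp_rotate h]
  simp only [lineOp, mul_assoc]

theorem lineOp_mul_self (h : IsLine i j k) : (lineOp i j k * lineOp i j k : V →L[ℝ] V) = 1 :=
  mul_mul_mul_self (lmE_mul_self i) (lmE_mul_self j) (lmE_mul_self k) (lmE_mul_lmE h.ne.symm)
    (lmE_mul_lmE h.rotate.rotate.ne) (lmE_mul_lmE h.rotate.ne.symm)

theorem one_add_lineOp_mul (h : IsLine i j k) :
    ((1 + lineOp i j k) * (lmE i + rmE i) : V →L[ℝ] V) = 0 := by
  have h₁ := lmo_mul_sub_eq_rmo_mul_rmo_sub (V := V) (e i.succ) (e j.succ)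
  have h₂ := lmo_mul_sub_eq_rmo_mul_rmo_sub (V := V) (e i.succ) (e k.succ)
  rw [h.mul_eq] at h₁
  rw [h.mul_eq_neg, lmo_neg, rmo_neg, sub_neg_eq_add] at h₂
  exact one_add_mul_mul_add_eq_zero (lmE_mul_self i) (lmE_mul_self k) (lmE_mul_lmE h.ne.symm)
    (lmE_mul_lmE h.rotate.rotate.ne) (lmE_mul_lmE h.rotate.ne.symm) (rmE_mul_self i) h₁ h₂

/-- `IsPencil p q r s t u v` says that the three lines of the Fano plane through `p` are
`{p, q, r}`, `{p, s, t}` and `{p, u, v}`, with these orientations. -/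
structure IsPencil (p q r s t u v : Fin 7) : Prop where
  line₁ : IsLine p q r
  line₂ : IsLine p s t
  line₃ : IsLine p u v
  nodup : [p, q, r, s, t, u, v].Nodup

instance (p q r s t u v : Fin 7) : Decidable (IsPencil p q r s t u v) :=
  decidable_of_iff (IsLine p q r ∧ IsLine p s t ∧ IsLine p u v ∧ [p, q, r, s, t, u, v].Nodup)
    ⟨fun h => ⟨h.1, h.2.1, h.2.2.1, h.2.2.2⟩, fun h => ⟨h.1, h.2, h.3, h.4⟩⟩

variable {p q r s t u v : Fin 7}

theorem IsPencil.rotate (h : IsPencil p q r s t u v) : IsPencil p s t u v q r := by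
  refine ⟨h.line₂, h.line₃, h.line₁, ?_⟩
  have := h.nodup
  grind

theorem IsPencil.swap (h : IsPencil p q r s t u v) : IsPencil p q r u v s t := by
  refine ⟨h.line₁, h.line₃, h.line₂, ?_⟩
  have := h.nodup
  grind

theorem two_mul_rmE_mul_lmE (h₁ : IsLine p q r) (h₂ : IsLine p s t) (hp : q ≠ p) (hs : q ≠ s)
    (ht : q ≠ t) : (2 * (rmE p * lmE p) : V →L[ℝ] V) =
      1 + lineOp p q r + lineOp p s t - lineOp p s t * lineOp p q r := by
  have h := lmo_mul_sub_eq_rmo_mul_lmo_sub (V := V) (e p.succ) (e q.succ)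
  rw [h₁.mul_eq] at h
  exact two_mul_mul_eq (lmE_mul_self p) (lmE_mul_self q) (lmE_mul_lmE h₁.ne.symm)
    (lmE_mul_lmE h₁.rotate.rotate.ne) (lmE_mul_lineOp_of_ne hp hs ht) h (one_add_lineOp_mul h₂)

theorem IsPencil.lineOp_mul_lineOp (h : IsPencil p q r s t u v) :
    (lineOp p q r * lineOp p s t : V →L[ℝ] V) = -lineOp p u v := by
  have hn := h.nodup
  simp only [List.nodup_cons, List.mem_cons, not_or, List.not_mem_nil, or_false] at hn
  have hu : (lmE u * lineOp p u v : V →L[ℝ] V) = lineOp p u v * lmE u := by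
    have := lmE_mul_lineOp_left (V := V) h.line₃.rotate
    rwa [lineOp_rotate h.line₃] at this
  refine eq_neg_mul_of_three (lmE_mul_self u)
    (two_mul_rmE_mul_lmE h.line₂ h.line₃ ?_ ?_ ?_) (two_mul_rmE_mul_lmE h.line₂ h.line₁ ?_ ?_ ?_)
    (lmE_mul_lineOp_of_ne ?_ ?_ ?_) hu (lmE_mul_lineOp_of_ne ?_ ?_ ?_) <;> grind

theorem IsPencil.two_mul_rmE_mul_lmE_eq (h : IsPencil p q r s t u v) :
    (2 * (rmE p * lmE p) : V →L[ℝ] V) = 1 + lineOp p q r + lineOp p s t + lineOp p u v := by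
  have hn := h.nodup
  simp only [List.nodup_cons, List.mem_cons, not_or, List.not_mem_nil, or_false] at hn
  rw [two_mul_rmE_mul_lmE h.line₁ h.line₂, h.rotate.swap.lineOp_mul_lineOp, sub_neg_eq_add] <;>
    grind

theorem IsPencil.lineOp_mul_add (h : IsPencil p q r s t u v) :
    (lineOp p q r * (lineOp p s t + lineOp p u v) : V →L[ℝ] V) =
      -(lineOp p s t + lineOp p u v) := by
  rw [mul_add, h.lineOp_mul_lineOp, h.swap.lineOp_mul_lineOp]
  abel

theorem IsPencil.add_mul_lineOp (h : IsPencil p q r s t u v) :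
    ((lineOp p s t + lineOp p u v) * lineOp p q r : V →L[ℝ] V) =
      -(lineOp p s t + lineOp p u v) := by
  rw [add_mul, h.rotate.swap.lineOp_mul_lineOp, h.rotate.rotate.lineOp_mul_lineOp]
  abel

theorem exists_isPencil (p : Fin 7) : ∃ q r s t u v, IsPencil p q r s t u v := by
  fin_cases p
  · exact ⟨1, 2, 3, 4, 6, 5, by decide⟩
  · exact ⟨2, 0, 3, 5, 4, 6, by decide⟩
  · exact ⟨0, 1, 3, 6, 5, 4, by decide⟩
  · exact ⟨4, 0, 5, 1, 6, 2, by decide⟩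
  · exact ⟨0, 3, 6, 1, 2, 5, by decide⟩
  · exact ⟨0, 6, 1, 3, 4, 2, by decide⟩
  · exact ⟨5, 0, 1, 4, 2, 3, by decide⟩

variable (V) in
/-- The sum of the line operators over the seven lines of the Fano plane. -/
def lineSum : V →L[ℝ] V :=
  lineOp 0 1 2 + lineOp 0 3 4 + lineOp 0 6 5 + lineOp 1 3 5 + lineOp 1 4 6 + lineOp 2 3 6 +
    lineOp 2 5 4

theorem lineOp_rotate_of_lt (h : IsLine i j k) (_ : j < i ∧ j < k) :
    (lineOp i j k : V →L[ℝ] V) = lineOp j k i :=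
  (lineOp_rotate h).symm

theorem lineOp_rotate_rotate_of_lt (h : IsLine i j k) (_ : k < i ∧ k < j) :
    (lineOp i j k : V →L[ℝ] V) = lineOp k i j :=
  lineOp_rotate h.rotate.rotate

theorem Oct.IsLine.induction {P : Fin 7 → Fin 7 → Fin 7 → Prop} (h : IsLine i j k)
    (h₁ : P 0 1 2) (h₂ : P 0 3 4) (h₃ : P 0 6 5) (h₄ : P 1 3 5) (h₅ : P 1 4 6) (h₆ : P 2 3 6)
    (h₇ : P 2 5 4) (hr : ∀ i j k, IsLine i j k → P i j k → P j k i) : P i j k := by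
  simp only [IsLine, List.mem_cons, Prod.mk.injEq, List.not_mem_nil, or_false] at h
  rcases h with h | h | h | h | h | h | h | h | h | h | h | h | h | h | h | h | h | h | h | h | h <;>
  · obtain ⟨rfl, rfl, rfl⟩ := h
    first
      | assumption
      | exact hr _ _ _ (by decide) (by assumption)
      | exact hr _ _ _ (by decide) (hr _ _ _ (by decide) (by assumption))

theorem lineOp_mul_lineSum_of_isPencil {a b c d a' b' c' d' a'' b'' c'' d'' : Fin 7}
    (h : IsPencil i j k a b c d) (h' : IsPencil j k i a' b' c' d')
    (h'' : IsPencil k i j a'' b'' c'' d'')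
    (hW : lineSum V = lineOp i j k + (lineOp i a b + lineOp i c d) +
      (lineOp j a' b' + lineOp j c' d') + (lineOp k a'' b'' + lineOp k c'' d'')) :
    (lineOp i j k * lineSum V = 1 + lineOp i j k - lineSum V) ∧
      lineSum V * lineOp i j k = 1 + lineOp i j k - lineSum V := by
  have hj : (lineOp j k i : V →L[ℝ] V) = lineOp i j k := lineOp_rotate h.line₁
  have hk : (lineOp k i j : V →L[ℝ] V) = lineOp i j k := (lineOp_rotate h''.line₁).symm
  have hs := lineOp_mul_self (V := V) h.line₁
  have l := h.lineOp_mul_add (V := V)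
  have l' := h'.lineOp_mul_add (V := V)
  have l'' := h''.lineOp_mul_add (V := V)
  have r := h.add_mul_lineOp (V := V)
  have r' := h'.add_mul_lineOp (V := V)
  have r'' := h''.add_mul_lineOp (V := V)
  rw [hj] at l' r'
  rw [hk] at l'' r''
  rw [hW]
  exact ⟨by linear_combination (norm := noncomm_ring) hs + l + l' + l'',
    by linear_combination (norm := noncomm_ring) hs + r + r' + r''⟩

theorem Oct.IsLine.lineOp_mul_lineSum (h : IsLine i j k) :
    (lineOp i j k * lineSum V = 1 + lineOp i j k - lineSum V) ∧
      lineSum V * lineOp i j k = 1 + lineOp i j k - lineSum V := by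
  refine h.induction (P := fun i j k => (lineOp i j k * lineSum V = 1 + lineOp i j k - lineSum V) ∧
    lineSum V * lineOp i j k = 1 + lineOp i j k - lineSum V) ?_ ?_ ?_ ?_ ?_ ?_ ?_ ?_
  · refine lineOp_mul_lineSum_of_isPencil (a := 3) (b := 4) (c := 6) (d := 5)
      (a' := 3) (b' := 5) (c' := 4) (d' := 6) (a'' := 3) (b'' := 6) (c'' := 5) (d'' := 4)
      (by decide) (by decide) (by decide) ?_
    simp only [lineSum]
    abel
  · refine lineOp_mul_lineSum_of_isPencil (a := 1) (b := 2) (c := 6) (d := 5)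
      (a' := 5) (b' := 1) (c' := 6) (d' := 2) (a'' := 6) (b'' := 1) (c'' := 2) (d'' := 5)
      (by decide) (by decide) (by decide) ?_
    simp (disch := decide) only [lineOp_rotate_of_lt, lineOp_rotate_rotate_of_lt, lineSum]
    abel
  · refine lineOp_mul_lineSum_of_isPencil (a := 1) (b := 2) (c := 3) (d := 4)
      (a' := 1) (b' := 4) (c' := 2) (d' := 3) (a'' := 1) (b'' := 3) (c'' := 4) (d'' := 2)
      (by decide) (by decide) (by decide) ?_
    simp (disch := decide) only [lineOp_rotate_of_lt, lineOp_rotate_rotate_of_lt, lineSum]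
    abel
  · refine lineOp_mul_lineSum_of_isPencil (a := 2) (b := 0) (c := 4) (d := 6)
      (a' := 4) (b' := 0) (c' := 6) (d' := 2) (a'' := 0) (b'' := 6) (c'' := 4) (d'' := 2)
      (by decide) (by decide) (by decide) ?_
    simp (disch := decide) only [lineOp_rotate_of_lt, lineOp_rotate_rotate_of_lt, lineSum]
    abel
  · refine lineOp_mul_lineSum_of_isPencil (a := 2) (b := 0) (c := 3) (d := 5)
      (a' := 0) (b' := 3) (c' := 2) (d' := 5) (a'' := 5) (b'' := 0) (c'' := 2) (d'' := 3)
      (by decide) (by decide) (by decide) ?_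
    simp (disch := decide) only [lineOp_rotate_of_lt, lineOp_rotate_rotate_of_lt, lineSum]
    abel
  · refine lineOp_mul_lineSum_of_isPencil (a := 0) (b := 1) (c := 5) (d := 4)
      (a' := 4) (b' := 0) (c' := 5) (d' := 1) (a'' := 5) (b'' := 0) (c'' := 1) (d'' := 4)
      (by decide) (by decide) (by decide) ?_
    simp (disch := decide) only [lineOp_rotate_of_lt, lineOp_rotate_rotate_of_lt, lineSum]
    abel
  · refine lineOp_mul_lineSum_of_isPencil (a := 0) (b := 1) (c := 3) (d := 6)
      (a' := 0) (b' := 6) (c' := 1) (d' := 3) (a'' := 0) (b'' := 3) (c'' := 6) (d'' := 1)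
      (by decide) (by decide) (by decide) ?_
    simp (disch := decide) only [lineOp_rotate_of_lt, lineOp_rotate_rotate_of_lt, lineSum]
    abel
  · intro i j k h h'
    rwa [lineOp_rotate h]

theorem rmE_mul_lmE_of_isPencil (h : IsPencil p q r s t u v) :
    (rmE p * lmE p : V →L[ℝ] V) =
      (1 / 2 : ℝ) • (1 + lineOp p q r + lineOp p s t + lineOp p u v) := by
  rw [← h.two_mul_rmE_mul_lmE_eq, two_mul]
  module

theorem reO_eq : reO V = (1 / 8 : ℝ) • (1 - lineSum V) := by
  have h : reO V = (5 / 12 : ℝ) • (1 : V →L[ℝ] V) - (1 / 12 : ℝ) • ∑ i, rmE i * lmE i := rfl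
  rw [h, Fin.sum_univ_seven,
    rmE_mul_lmE_of_isPencil (p := 0) (q := 1) (r := 2) (s := 3) (t := 4) (u := 6) (v := 5)
      (by decide),
    rmE_mul_lmE_of_isPencil (p := 1) (q := 2) (r := 0) (s := 3) (t := 5) (u := 4) (v := 6)
      (by decide),
    rmE_mul_lmE_of_isPencil (p := 2) (q := 0) (r := 1) (s := 3) (t := 6) (u := 5) (v := 4)
      (by decide),
    rmE_mul_lmE_of_isPencil (p := 3) (q := 4) (r := 0) (s := 5) (t := 1) (u := 6) (v := 2)
      (by decide),
    rmE_mul_lmE_of_isPencil (p := 4) (q := 0) (r := 3) (s := 6) (t := 1) (u := 2) (v := 5)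
      (by decide),
    rmE_mul_lmE_of_isPencil (p := 5) (q := 0) (r := 6) (s := 1) (t := 3) (u := 4) (v := 2)
      (by decide),
    rmE_mul_lmE_of_isPencil (p := 6) (q := 5) (r := 0) (s := 1) (t := 4) (u := 2) (v := 3)
      (by decide)]
  simp (disch := decide) only [lineOp_rotate_of_lt, lineOp_rotate_rotate_of_lt, lineSum]
  module

theorem lineOp_mul_reO (h : IsLine i j k) : lineOp i j k * reO V = -reO V := by
  rw [reO_eq, mul_smul_comm, mul_sub, mul_one, h.lineOp_mul_lineSum.1]
  module

theorem reO_mul_lineOp (h : IsLine i j k) : reO V * lineOp i j k = -reO V := by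
  rw [reO_eq, smul_mul_assoc, sub_mul, one_mul, h.lineOp_mul_lineSum.2]
  module

theorem reO_mul_lineSum : reO V * lineSum V = (-7 : ℝ) • reO V := by
  simp (disch := decide) only [lineSum, mul_add, reO_mul_lineOp]
  module

theorem reO_mul_self : reO V * reO V = reO V := by
  nth_rw 2 [reO_eq]
  rw [mul_smul_comm, mul_sub, mul_one, reO_mul_lineSum]
  module

theorem IsPencil.rmE_eq (h : IsPencil p q r s t u v) : (rmE p : V →L[ℝ] V) =
    -((1 / 2 : ℝ) • ((1 + lineOp p q r + lineOp p s t + lineOp p u v) * lmE p)) := by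
  rw [← smul_mul_assoc, ← rmE_mul_lmE_of_isPencil h, mul_assoc, lmE_mul_self, mul_neg_one, neg_neg]

theorem lmE_mul_reO (i : Fin 7) : lmE i * reO V = rmE i * reO V := by
  obtain ⟨q, r, s, t, u, v, h⟩ := exists_isPencil i
  have h' : ((1 + lineOp i q r + lineOp i s t + lineOp i u v) * lmE i : V →L[ℝ] V) =
      lmE i * (1 + lineOp i q r + lineOp i s t + lineOp i u v) := by
    simp only [add_mul, mul_add, lmE_mul_lineOp_left h.line₁, lmE_mul_lineOp_left h.line₂,
      lmE_mul_lineOp_left h.line₃, mul_one, one_mul]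
  rw [h.rmE_eq, h', neg_mul, smul_mul_assoc, mul_assoc, add_mul, add_mul, add_mul,
    lineOp_mul_reO h.line₁, lineOp_mul_reO h.line₂, lineOp_mul_reO h.line₃, one_mul]
  simp only [mul_add, mul_neg]
  module

theorem reO_mul_lmE (i : Fin 7) : reO V * lmE i = reO V * rmE i := by
  obtain ⟨q, r, s, t, u, v, h⟩ := exists_isPencil i
  rw [h.rmE_eq, mul_neg, mul_smul_comm, ← mul_assoc, mul_add, mul_add, mul_add,
    reO_mul_lineOp h.line₁, reO_mul_lineOp h.line₂, reO_mul_lineOp h.line₃, mul_one]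
  simp only [add_mul, neg_mul]
  module

/-- Two continuous linear expressions in an octonion agree once they agree on the basis. -/
theorem Oct.ext_e {M : Type*} [AddCommGroup M] [Module ℝ M] {f g : Oct →ₗ[ℝ] M}
    (h₁ : f 1 = g 1) (h : ∀ i : Fin 7, f (e i.succ) = g (e i.succ)) : f = g := by
  ext p
  rw [← sum_re_e_mul_smul_conj_e p, map_sum, map_sum]
  refine Finset.sum_congr rfl fun i _ => ?_
  rw [map_smul, map_smul]
  congr 1
  induction i using Fin.cases with
  | zero => rwa [conj_e_zero]
  | succ i => rw [conj_e_succ, map_neg, map_neg, h]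

theorem lmo_mul_reO (p : Oct) : lmo p * reO V = rmo p * reO V := by
  have h : (LinearMap.mulRight ℝ (reO V)).comp (OctBimodule.lm : Oct →ₗ[ℝ] V →L[ℝ] V) =
      (LinearMap.mulRight ℝ (reO V)).comp OctBimodule.rm :=
    Oct.ext_e (congrArg (· * reO V) (lmo_one.trans rmo_one.symm)) lmE_mul_reO
  exact LinearMap.congr_fun h p

theorem reO_mul_lmo (p : Oct) : reO V * lmo p = reO V * rmo p := by
  have h : (LinearMap.mulLeft ℝ (reO V)).comp (OctBimodule.lm : Oct →ₗ[ℝ] V →L[ℝ] V) =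
      (LinearMap.mulLeft ℝ (reO V)).comp OctBimodule.rm :=
    Oct.ext_e (congrArg (reO V * ·) (lmo_one.trans rmo_one.symm)) reO_mul_lmE
  exact LinearMap.congr_fun h p

theorem rmo_mul_rmo_mul_reO (p q : Oct) : rmo q * rmo p * reO V = rmo (p * q) * reO V := by
  have h₁ := congrArg (· * reO V) (lmo_mul_sub_eq_rmo_mul_lmo_sub (V := V) p q)
  have h₂ := congrArg (· * reO V) (lmo_mul_sub_eq_rmo_mul_rmo_sub (V := V) p q)
  have h₃ := congrArg (· * reO V) (lmo_mul_sub_eq_neg (V := V) p q)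
  have h₄ := congrArg (· * reO V) (lmo_mul_sub_eq_rmo_mul_rmo_sub (V := V) q p)
  have h : (3 : ℝ) • (rmo q * rmo p * reO V - rmo (p * q) * reO V) = 0 := by
    simp only [sub_mul, neg_mul, mul_assoc, lmo_mul_reO] at h₁ h₂ h₃ h₄ ⊢
    have h₅ : rmo q * (rmo p * reO V) - rmo (p * q) * reO V =
      (-2 : ℝ) • (rmo q * (rmo p * reO V) - rmo (p * q) * reO V) := by
      rw [← h₂, neg_smul, two_smul]
      linear_combination (norm := abel) h₁ + h₃ + h₃ - h₄
    linear_combination (norm := module) h₅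
  exact sub_eq_zero.1 ((smul_eq_zero_iff_right three_ne_zero).1 h)

theorem reO_mul_rmo_mul_rmo (p q : Oct) : reO V * rmo q * rmo p = reO V * rmo (p * q) := by
  have h₁ := congrArg (reO V * ·) (lmo_mul_sub_eq_rmo_mul_lmo_sub (V := V) p q)
  have h₂ := congrArg (reO V * ·) (lmo_mul_sub_eq_rmo_mul_rmo_sub (V := V) p q)
  have h : (3 : ℝ) • (reO V * rmo q * rmo p - reO V * rmo (p * q)) = 0 := by
    simp only [mul_sub, ← mul_assoc, reO_mul_lmo] at h₁ h₂
    linear_combination (norm := module) h₁ - (2 : ℝ) • h₂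
  exact sub_eq_zero.1 ((smul_eq_zero_iff_right three_ne_zero).1 h)

theorem reO_mul_lmE_mul_reO (i : Fin 7) : reO V * lmE i * reO V = 0 := by
  obtain ⟨a, b, c, h, ha, hb, hc⟩ := exists_isLine_notMem i
  have h₁ := lmE_mul_lineOp_of_ne (V := V) ha hb hc
  have h₂ := lineOp_mul_reO (V := V) h
  have h₃ := reO_mul_lineOp (V := V) h
  have h₄ : (2 : ℝ) • (reO V * lmE i * reO V) = 0 := by
    rw [two_smul]
    linear_combination (norm := noncomm_ring)
      reO V * lmE i * h₂ + h₃ * lmE i * reO V - reO V * h₁ * reO V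
  exact (smul_eq_zero_iff_right two_ne_zero).1 h₄

theorem reO_mul_rmo_mul_reO (p : Oct) : reO V * rmo p * reO V = re p • reO V := by
  have h : ((LinearMap.mulRight ℝ (reO V)).comp (LinearMap.mulLeft ℝ (reO V))).comp
      (OctBimodule.rm : Oct →ₗ[ℝ] V →L[ℝ] V) =
      LinearMap.smulRight ⟨⟨re, fun _ _ => rfl⟩, fun _ _ => rfl⟩ (reO V) := by
    refine Oct.ext_e ?_ fun i => ?_
    · change reO V * rmo 1 * reO V = (1 : ℝ) • reO V
      rw [rmo_one, mul_one, reO_mul_self, one_smul]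
    · change reO V * rmE i * reO V = re (e i.succ) • reO V
      rw [re_e_succ, zero_smul, ← reO_mul_lmE, reO_mul_lmE_mul_reO]
  exact LinearMap.congr_fun h p

theorem sum_lmE_mul_lineOp_mul_lmE (h : IsLine i j k) :
    ∑ x, lmE x * lineOp i j k * lmE x = (lineOp i j k : V →L[ℝ] V) := by
  have hx : ∀ x, (lmE x * lineOp i j k * lmE x : V →L[ℝ] V) =
      (if x = i ∨ x = j ∨ x = k then -1 else 1 : ℤ) • lineOp i j k := by
    intro x
    split_ifs with hx
    · have hc : (lmE x * lineOp i j k : V →L[ℝ] V) = lineOp i j k * lmE x := by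
        rcases hx with rfl | rfl | rfl
        · exact lmE_mul_lineOp_left h
        · rw [← lineOp_rotate h, lmE_mul_lineOp_left h.rotate]
        · rw [← lineOp_rotate h, ← lineOp_rotate h.rotate, lmE_mul_lineOp_left h.rotate.rotate]
      rw [hc, mul_assoc, lmE_mul_self, mul_neg_one, neg_one_smul]
    · simp only [not_or] at hx
      rw [lmE_mul_lineOp_of_ne hx.1 hx.2.1 hx.2.2, neg_mul, mul_assoc, lmE_mul_self, mul_neg_one,
        neg_neg, one_smul]
  have hs : ∀ i j k, IsLine i j k →
      ∑ x : Fin 7, (if x = i ∨ x = j ∨ x = k then -1 else 1 : ℤ) = 1 := by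
    decide
  rw [Finset.sum_congr rfl fun x _ => hx x, ← Finset.sum_smul, hs i j k h, one_smul]

theorem sum_lmE_mul_lineSum_mul_lmE : ∑ x, lmE x * lineSum V * lmE x = lineSum V := by
  simp (disch := decide) only [lineSum, mul_add, add_mul, Finset.sum_add_distrib,
    sum_lmE_mul_lineOp_mul_lmE]

/-- Every element is the sum of its real components times the basis octonions. -/
theorem sum_rmo_mul_reO_mul_rmo_conj :
    ∑ i : Fin 8, rmo (e i) * reO V * rmo (conj (e i)) = 1 := by
  have h : ∀ x : Fin 7, rmo (e x.succ) * reO V * rmo (conj (e x.succ)) =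
      (-(1 / 8) : ℝ) • (-1 - lmE x * lineSum V * lmE x) := by
    intro x
    rw [conj_e_succ, rmo_neg, mul_neg]
    change -(rmE x * reO V * rmE x) = _
    rw [← lmE_mul_reO, mul_assoc, ← reO_mul_lmE, ← mul_assoc, reO_eq, mul_smul_comm, smul_mul_assoc,
      mul_sub, sub_mul, mul_one, lmE_mul_self]
    module
  rw [Fin.sum_univ_succ, Finset.sum_congr rfl fun x _ => h x, ← Finset.smul_sum,
    Finset.sum_sub_distrib, sum_lmE_mul_lineSum_mul_lmE, conj_e_zero, e_zero, rmo_one, one_mul,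
    mul_one, reO_eq, Finset.sum_const, Finset.card_univ, Fintype.card_fin]
  module

theorem isRightPara_iff {T : V →L[ℝ] V} :
    IsRightPara T ↔ ∀ p, reO V * rmo p * T = reO V * T * rmo p := by
  refine forall_congr' fun p => ⟨fun h => ContinuousLinearMap.ext fun x => sub_eq_zero.1 ?_,
    fun h x => ?_⟩
  · exact (map_sub (reO V) _ _).symm.trans (h x)
  · exact (map_sub (reO V) _ _).trans (sub_eq_zero.2 (DFunLike.congr_fun h x))

theorem isRightPara_one : IsRightPara (1 : V →L[ℝ] V) :=
  isRightPara_iff.2 fun p => by rw [mul_one, mul_one]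

theorem lifO_reO_mul (S : V →L[ℝ] V) :
    lifO (reO V * S) = ∑ i : Fin 8, rmo (e i) * reO V * S * rmo (conj (e i)) := by
  simp only [mul_assoc]
  rfl

theorem extO_eq_sum (S : V →L[ℝ] V) :
    extO S = ∑ i : Fin 8, rmo (e i) * S * reO V * rmo (conj (e i)) := by
  simp only [mul_assoc]
  rfl

theorem sum_rmo_mul_reO_mul_rmo_conj_mul (S : V →L[ℝ] V) :
    ∑ i : Fin 8, rmo (e i) * (reO V * rmo (conj (e i)) * S) = S := by
  conv_rhs => rw [← one_mul S, ← sum_rmo_mul_reO_mul_rmo_conj, Finset.sum_mul]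
  simp only [mul_assoc]

/-- An operator is determined by the real parts of its right multiples. -/
theorem eq_of_reO_mul_rmo_mul {S S' : V →L[ℝ] V}
    (h : ∀ p, reO V * rmo p * S = reO V * rmo p * S') : S = S' := by
  rw [← sum_rmo_mul_reO_mul_rmo_conj_mul S, ← sum_rmo_mul_reO_mul_rmo_conj_mul S']
  simp only [h]

variable {T : V →L[ℝ] V}

theorem IsRightPara.lifO_reO_mul_eq (hT : IsRightPara T) : lifO (reO V * T) = T := by
  rw [lifO_reO_mul]
  conv_rhs => rw [← sum_rmo_mul_reO_mul_rmo_conj_mul T]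
  simp only [isRightPara_iff.1 hT, mul_assoc]

theorem reO_mul_rmo_mul_lifO (S : V →L[ℝ] V) (p : Oct) :
    reO V * rmo p * lifO (reO V * S) = reO V * S * rmo p := by
  have h : ∀ i : Fin 8, reO V * rmo p * (rmo (e i) * reO V * S * rmo (conj (e i))) =
      reO V * S * (re (e i * p) • rmo (conj (e i))) := by
    intro i
    rw [mul_smul_comm, ← smul_mul_assoc, ← smul_mul_assoc, ← reO_mul_rmo_mul_reO,
      ← reO_mul_rmo_mul_rmo]
    simp only [mul_assoc]
  have h' : (rmo p : V →L[ℝ] V) = ∑ i, re (e i * p) • rmo (conj (e i)) := by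
    conv_lhs => rw [← sum_re_e_mul_smul_conj_e p]
    simp only [rmo, map_sum, map_smul]
  rw [lifO_reO_mul, Finset.mul_sum, Finset.sum_congr rfl fun i _ => h i, ← Finset.mul_sum, ← h']

theorem isRightPara_lifO_reO_mul (S : V →L[ℝ] V) : IsRightPara (lifO (reO V * S)) := by
  refine isRightPara_iff.2 fun p => ?_
  have h := reO_mul_rmo_mul_lifO S 1
  rw [rmo_one, mul_one, mul_one] at h
  rw [reO_mul_rmo_mul_lifO, h]

theorem isRightPara_iff_lifO_reO_mul_eq : IsRightPara T ↔ lifO (reO V * T) = T :=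
  ⟨fun h => h.lifO_reO_mul_eq, fun h => h ▸ isRightPara_lifO_reO_mul T⟩

theorem IsRightPara.mul_rmo_mul_reO (hT : IsRightPara T) (p : Oct) :
    T * rmo p * reO V = rmo p * T * reO V := by
  rw [isRightPara_iff] at hT
  refine eq_of_reO_mul_rmo_mul fun q => ?_
  calc reO V * rmo q * (T * rmo p * reO V)
      = reO V * T * (rmo q * rmo p * reO V) := by
        rw [mul_assoc T, ← mul_assoc, hT]
        simp only [mul_assoc]
    _ = reO V * T * rmo (p * q) * reO V := by rw [rmo_mul_rmo_mul_reO, ← mul_assoc]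
    _ = reO V * rmo q * rmo p * T * reO V := by rw [← hT, reO_mul_rmo_mul_rmo]
    _ = reO V * rmo q * (rmo p * T * reO V) := by simp only [mul_assoc]

theorem IsRightPara.extO_eq (hT : IsRightPara T) : extO T = T := by
  rw [extO_eq_sum]
  conv_rhs => rw [← mul_one T, ← sum_rmo_mul_reO_mul_rmo_conj, Finset.mul_sum]
  refine Finset.sum_congr rfl fun i _ => ?_
  rw [← hT.mul_rmo_mul_reO]
  simp only [mul_assoc]

theorem forall_compAssoc_eq_zero_iff {f g : V →L[ℝ] V} :
    (∀ x, compAssoc f g x = 0) ↔ IsRightPara (f * g) := by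
  rw [isRightPara_iff_lifO_reO_mul_eq, ContinuousLinearMap.ext_iff]
  exact forall_congr' fun x => sub_eq_zero

end BimoduleOperators

/-- For a bounded right para-linear operator `T` on a Banach `𝕆`-bimodule
`V` the following are equivalent: (1) `[T, T^{⊚n}, x]_⊚ = 0` for all `x, n`; (2) `Tⁿ` is
right para-linear for all `n`; (3) `[T^{n⊚}, T, x]_⊚ = 0` for all `x, n`.  Moreover, under
any of these conditions `T^{⊚n} = Tⁿ = T^{n⊚}` and `Tⁿ ⊚ Tᵐ = T^{n+m}`. -/
theorem statement_3 {V : Type*} [NormedAddCommGroup V] [NormedSpace ℝ V] [CompleteSpace V]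
    [OctBimodule V] (T : V →L[ℝ] V) (hT : IsRightPara T) :
    ((∀ (n : ℕ) (x : V), compAssoc T (rpowR T n) x = 0) ↔ ∀ n : ℕ, IsRightPara (T ^ n)) ∧
    ((∀ n : ℕ, IsRightPara (T ^ n)) ↔ ∀ (n : ℕ) (x : V), compAssoc (rpowL T n) T x = 0) ∧
    ((∀ n : ℕ, IsRightPara (T ^ n)) →
      (∀ n : ℕ, rpowR T n = T ^ n ∧ rpowL T n = T ^ n) ∧
      ∀ n m : ℕ, rcomp (T ^ n) (T ^ m) = T ^ (n + m)) := by
  have hR : ∀ n, IsRightPara (T ^ n) → rpowR T n = T ^ n := fun n h => h.extO_eq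
  have hL : ∀ n, IsRightPara (T ^ n) → rpowL T n = T ^ n := fun n h => h.lifO_reO_mul_eq
  simp only [forall_compAssoc_eq_zero_iff]
  refine ⟨⟨fun h n => ?_, fun h n => ?_⟩, ⟨fun h n => ?_, fun h n => ?_⟩,
    fun h => ⟨fun n => ⟨hR n (h n), hL n (h n)⟩, fun n m => ?_⟩⟩
  · induction n with
    | zero => exact isRightPara_one
    | succ n ih =>
      rw [pow_succ', ← hR n ih]
      exact h n
  · rw [hR n (h n), ← pow_succ']
    exact h (n + 1)
  · rw [hL n (h n), ← pow_succ]
    exact h (n + 1)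
  · induction n with
    | zero => exact isRightPara_one
    | succ n ih =>
      rw [pow_succ, ← hL n ih]
      exact h n
  · rw [pow_add]
    exact IsRightPara.lifO_reO_mul_eq (T := T ^ n * T ^ m) (pow_add T n m ▸ h (n + m))
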